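/- arXiv:2603.01244 — 2 statements merged into one kernel-verified Lean document; each statement's English description precedes it below -/
import Mathlib

section
/- Let t ≥ 4, let S_black be any sequence of stacks of a color black distinct from red, blue, green, and let S' = S_initial + S_reservation + S_black + S_connector on the nine-vertex spider graph G'. Then in every placement of S' that empties the board, the configuration reached after placing the first eight stacks (i.e., after S_initial + S_reservation) is as follows for some i ∈ {1,2,3}: the center x and the leaf ℓ_b^i each hold a red stack of height t−1, the vertices s_1 and s_2 each hold a blue stack of height t−1, and all other vertices are empty. -/
open scoped Classical

namespace Hexasort

/-- A board configuration: each vertex holds either a stack `(color, height)` or nothing. -/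
abbrev Config (V C : Type*) := V → Option (C × ℕ)

/-- The everywhere-empty configuration. -/
def emptyConfig (V C : Type*) : Config V C := fun _ => none

/-- The height contributed by a board entry to color `c` (0 if empty or another color). -/
noncomputable def colorHeight {C : Type*} (e : Option (C × ℕ)) (c : C) : ℕ :=
  match e with
  | none => 0
  | some (c', h) => if c' = c then h else 0

/-- Total height of the color-`c` stacks on the neighbors of `x`. -/
noncomputable def neighborSum {V C : Type*} [Fintype V] (G : SimpleGraph V)
    (δ : Config V C) (c : C) (x : V) : ℕ :=
  ∑ y ∈ Finset.univ.filter (fun y => G.Adj x y), colorHeight (δ y) c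

/-- The configuration resulting from placing the stack `s` on the vertex `x`:
all same-colored neighbors are emptied, and `x` gets the merged stack unless
its total height reaches the threshold `t`, in which case `x` becomes empty. -/
noncomputable def place {V C : Type*} [Fintype V] (G : SimpleGraph V) (t : ℕ)
    (δ : Config V C) (s : C × ℕ) (x : V) : Config V C :=
  fun v =>
    if v = x then
      (if t ≤ s.2 + neighborSum G δ s.1 x then none
       else some (s.1, s.2 + neighborSum G δ s.1 x))
    else if G.Adj x v ∧ (∃ hh, δ v = some (s.1, hh)) then none
    else δ v

/-- Play a sequence of stacks on a sequence of vertices, starting from `δ`. -/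
noncomputable def play {V C : Type*} [Fintype V] (G : SimpleGraph V) (t : ℕ) :
    Config V C → List (C × ℕ) → List V → Config V C
  | δ, [], _ => δ
  | δ, _ :: _, [] => δ
  | δ, s :: S, x :: p => play G t (place G t δ s x) S p

/-- Legality of playing the stacks `S` on the vertices `p`, starting from `δ`:
each stack is placed on a vertex that is empty at that moment. -/
inductive Legal {V C : Type*} [Fintype V] (G : SimpleGraph V) (t : ℕ) :
    Config V C → List (C × ℕ) → List V → Prop
  | nil (δ : Config V C) : Legal G t δ [] []
  | cons {δ : Config V C} (s : C × ℕ) (S : List (C × ℕ)) (x : V) (p : List V) :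
      δ x = none → Legal G t (place G t δ s x) S p →
      Legal G t δ (s :: S) (x :: p)

/-- `S` is fittable on `(G, t)`: all stacks can be placed in order. -/
def Fittable {V C : Type*} [Fintype V] (G : SimpleGraph V) (t : ℕ)
    (S : List (C × ℕ)) : Prop :=
  ∃ p : List V, Legal G t (emptyConfig V C) S p

/-- `S` is emptyable on `(G, t)`: all stacks can be placed in order so that the
final configuration is everywhere empty. -/
def Emptyable {V C : Type*} [Fintype V] (G : SimpleGraph V) (t : ℕ)
    (S : List (C × ℕ)) : Prop :=
  ∃ p : List V, Legal G t (emptyConfig V C) S p ∧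
    play G t (emptyConfig V C) S p = emptyConfig V C

end Hexasort

namespace Hexasort

/-- The vertices of the nine-vertex spider graph `G'`: a center `x`, two short-arm
leaves `s1, s2`, and three long arms `x – la i – lb i` for `i ∈ {0,1,2}`. -/
inductive SpiderV : Type
  | x | s1 | s2 | la : Fin 3 → SpiderV | lb : Fin 3 → SpiderV
  deriving DecidableEq, Fintype

/-- The nine-vertex spider graph `G'`. -/
def spiderG : SimpleGraph SpiderV :=
  SimpleGraph.fromRel (fun u v =>
    (u = .x ∧ v = .s1) ∨ (u = .x ∧ v = .s2) ∨
    (∃ i, u = .x ∧ v = .la i) ∨ (∃ i, u = .la i ∧ v = .lb i))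

/-- `S_initial = ⟨(red,t−1),(red,t−1),(blue,t−1),(blue,t−1)⟩`. -/
def Sinitial {C : Type*} (red blue : C) (t : ℕ) : List (C × ℕ) :=
  [(red, t-1), (red, t-1), (blue, t-1), (blue, t-1)]

/-- `S_reservation = ⟨(green,⌊t/2⌋+1),(green,⌊t/2⌋+1),(green,⌈t/2⌉−1),(green,⌈t/2⌉−1)⟩`. -/
def Sreservation {C : Type*} (green : C) (t : ℕ) : List (C × ℕ) :=
  [(green, t/2 + 1), (green, t/2 + 1), (green, (t+1)/2 - 1), (green, (t+1)/2 - 1)]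

/-- `S_connector = ⟨(red,t−1),(blue,t−1)⟩`. -/
def Sconnector {C : Type*} (red blue : C) (t : ℕ) : List (C × ℕ) :=
  [(red, t-1), (blue, t-1)]

end Hexasort

namespace Hexasort


noncomputable def nsum {V : Type*} [Fintype V] (G : SimpleGraph V) (f : V → ℕ) (x : V) : ℕ :=
  ∑ y ∈ Finset.univ.filter (fun y => G.Adj x y), f y

noncomputable def upd {V : Type*} [Fintype V] (G : SimpleGraph V) (t : ℕ) (f : V → ℕ) (k : ℕ)
    (x : V) : V → ℕ :=
  fun v => if v = x then (if t ≤ k + nsum G f x then 0 else k + nsum G f x)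
    else if G.Adj x v then 0 else f v

noncomputable def ch {V C : Type*} (δ : Config V C) (c : C) : V → ℕ :=
  fun v => colorHeight (δ v) c

section
variable {V C : Type*} [Fintype V] (G : SimpleGraph V) (t : ℕ)

theorem ch_place_same (δ : Config V C) (c : C) (k : ℕ) (x : V) :
    ch (place G t δ (c, k) x) c = upd G t (ch δ c) k x := by
  funext v
  have hn : neighborSum G δ c x = nsum G (ch δ c) x := rfl
  change colorHeight (place G t δ (c, k) x v) c = _
  have hd : colorHeight (δ v) c = ch δ c v := rfl
  unfold place upd
  simp only [hn]
  by_cases hv : v = x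
  · simp only [hv, if_true]
    split_ifs <;> simp [colorHeight]
  · simp only [hv, if_false]
    by_cases ha : G.Adj x v
    · simp only [ha, true_and, if_true]
      split_ifs with h
      · simp [colorHeight]
      · rcases hdv : δ v with _ | ⟨c', h'⟩
        · simp [colorHeight]
        · by_cases hc : c' = c
          · subst hc; exact absurd ⟨h', hdv⟩ h
          · simp [colorHeight, hc]
    · simp [ha, hd]

theorem ch_place_diff (δ : Config V C) (c c' : C) (hc : c' ≠ c) (k : ℕ) (x : V)
    (hx : δ x = none) :
    ch (place G t δ (c', k) x) c = ch δ c := by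
  funext v
  unfold ch place
  by_cases hv : v = x
  · subst hv
    simp only [if_true, hx]
    split_ifs <;> simp [colorHeight, hc]
  · simp only [hv, if_false]
    split_ifs with h
    · obtain ⟨_, hh, h⟩ := h
      simp [h, colorHeight, hc]
    · rfl

theorem legal_append (S T : List (C × ℕ)) : ∀ (δ : Config V C) (p : List V),
    Legal G t δ (S ++ T) p → ∃ p1 p2, p = p1 ++ p2 ∧ p1.length = S.length ∧ Legal G t δ S p1 ∧
      Legal G t (play G t δ S p1) T p2 ∧
      play G t δ (S ++ T) p = play G t (play G t δ S p1) T p2 := by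
  induction S with
  | nil =>
    intro δ p h
    exact ⟨[], p, rfl, rfl, Legal.nil _, by simpa [play] using h, by simp [play]⟩
  | cons s S ih =>
    intro δ p h
    cases h with
    | cons _ _ x p hx h =>
      obtain ⟨p1, p2, rfl, hl, h1, h2, h3⟩ := ih _ _ h
      exact ⟨x :: p1, p2, rfl, by simp [hl], Legal.cons _ _ _ _ hx h1, h2, h3⟩

theorem ch_black (black c : C) (hc : black ≠ c) (hs : List ℕ) : ∀ (δ : Config V C) (p : List V),
    Legal G t δ (hs.map (fun h => (black, h))) p →
    ch (play G t δ (hs.map (fun h => (black, h))) p) c = ch δ c := by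
  induction hs with
  | nil => intro δ p _; simp [play]
  | cons s S ih =>
    intro δ p h
    cases h with
    | cons _ _ x p hx h =>
      have := ih _ _ h
      simp only [List.map_cons, play]
      rw [this, ch_place_diff G t δ c black hc _ _ hx]

theorem ch_none {V C : Type*} {δ : Config V C} {x : V} (h : δ x = none) (c : C) : ch δ c x = 0 := by
  simp [ch, h, colorHeight]

theorem nsum_ge (f : V → ℕ) (x y : V) (h : G.Adj x y) : f y ≤ nsum G f x :=
  Finset.single_le_sum (f := f) (fun _ _ => Nat.zero_le _) (by simp [h])

theorem nsum_zero (f : V → ℕ) (x : V) (h : ∀ y, G.Adj x y → f y = 0) : nsum G f x = 0 :=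
  Finset.sum_eq_zero (fun y hy => h y (by simpa using hy))

theorem upd_far (f : V → ℕ) (k : ℕ) (x : V) (hk : k < t) (h : ∀ y, G.Adj x y → f y = 0) (v : V) :
    upd G t f k x v = if v = x then k else f v := by
  unfold upd
  rw [nsum_zero G f x h]
  split_ifs with h1 h2 h3
  · omega
  · rfl
  · exact (h v h3).symm
  · rfl

theorem upd_clear (f : V → ℕ) (k : ℕ) (x y : V) (h : G.Adj x y) (hk : t ≤ k + f y) (v : V) :
    upd G t f k x v = if v = x ∨ G.Adj x v then 0 else f v := by
  have := nsum_ge G f x y h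
  unfold upd
  rw [if_pos (show t ≤ k + nsum G f x by omega)]
  split_ifs <;> simp_all

theorem adj_of_clear (f : V → ℕ) (k : ℕ) (x v : V) (hx : f x = 0) (hv : f v ≠ 0)
    (h : upd G t f k x v = 0) : G.Adj x v := by
  unfold upd at h
  by_cases h1 : v = x
  · subst h1; exact absurd hx hv
  · by_contra h2
    simp [h1, h2] at h
    exact hv h

theorem upd_ne (f : V → ℕ) (k : ℕ) (x : V) (hk : 0 < k) (hlt : k + nsum G f x < t) :
    upd G t f k x x ≠ 0 := by
  unfold upd
  rw [if_pos rfl, if_neg (by omega)]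
  omega

/-- three stacks of height `t-1` -/
theorem triple (ht : 4 ≤ t) (r1 r2 r3 : V) (f2 : V → ℕ)
    (h2 : f2 = upd G t (upd G t 0 (t-1) r1) (t-1) r2)
    (e2 : upd G t 0 (t-1) r1 r2 = 0) (e3 : f2 r3 = 0)
    (h3 : ∀ v, upd G t f2 (t-1) r3 v = 0) :
    r1 ≠ r2 ∧ ¬ G.Adj r2 r1 ∧ G.Adj r3 r1 ∧ G.Adj r3 r2 ∧
      ∀ v, f2 v = if v = r1 ∨ v = r2 then t - 1 else 0 := by
  have f1 : ∀ v, upd G t 0 (t-1) r1 v = if v = r1 then t-1 else 0 := by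
    intro v; rw [upd_far G t _ _ _ (by omega) (by simp)]; rfl
  have hne : r1 ≠ r2 := by
    rintro rfl
    rw [f1] at e2; simp at e2; omega
  have hna : ¬ G.Adj r2 r1 := by
    intro ha
    have z : ∀ v, f2 v = 0 := by
      intro v
      rw [h2, upd_clear G t _ _ _ r1 ha (by rw [f1]; simp; omega), f1]
      split_ifs with h3 h4
      · rfl
      · subst h4; exact absurd (Or.inr ha) h3
      · rfl
    have := h3 r3
    rw [upd_far G t _ _ _ (by omega) (fun y _ => z y)] at this
    simp at this; omega
  have hf : ∀ v, f2 v = if v = r1 ∨ v = r2 then t - 1 else 0 := by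
    intro v
    rw [h2, upd_far G t _ _ _ (by omega), f1]
    · by_cases h : v = r1 <;> by_cases h' : v = r2 <;> simp [h, h']
    · intro y hy
      rw [f1, if_neg]
      rintro rfl; exact hna hy
  refine ⟨hne, hna, ?_, ?_, hf⟩
  · exact adj_of_clear G t _ _ _ _ e3 (by rw [hf]; simp; omega) (h3 _)
  · exact adj_of_clear G t _ _ _ _ e3 (by rw [hf]; simp; omega) (h3 _)

theorem greens (a b : ℕ) (hab : a + b = t) (hb : 0 < b) (hbb : b + b < t) (g1 g2 g3 g4 : V)
    (f1 f2 f3 : V → ℕ) (h1 : f1 = upd G t 0 a g1) (h2 : f2 = upd G t f1 a g2)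
    (h3 : f3 = upd G t f2 b g3) (h4 : ∀ v, upd G t f3 b g4 v = 0)
    (e2 : f1 g2 = 0) (e3 : f2 g3 = 0) (e4 : f3 g4 = 0) :
    g1 ≠ g2 ∧ ¬ G.Adj g2 g1 ∧
    ((g3 ≠ g1 ∧ g3 ≠ g2 ∧ G.Adj g4 g1 ∧ G.Adj g4 g2 ∧ G.Adj g4 g3) ∨
     (G.Adj g3 g1 ∧ ¬ G.Adj g3 g2 ∧ G.Adj g4 g2) ∨
     (G.Adj g3 g2 ∧ ¬ G.Adj g3 g1 ∧ G.Adj g4 g1)) := by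
  have F1 : ∀ v, f1 v = if v = g1 then a else 0 := by
    intro v; rw [h1, upd_far G t _ _ _ (by omega) (by simp)]; rfl
  have hne : g1 ≠ g2 := by
    rintro rfl
    rw [F1] at e2; simp at e2; omega
  have hna : ¬ G.Adj g2 g1 := by
    intro ha
    have z : ∀ v, f2 v = 0 := by
      intro v
      rw [h2, upd_clear G t _ _ _ g1 ha (by rw [F1]; simp; omega), F1]
      split_ifs with h3 h4
      · rfl
      · subst h4; exact absurd (Or.inr ha) h3
      · rfl
    have F3 : ∀ v, f3 v = if v = g3 then b else 0 := by
      intro v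
      rw [h3, upd_far G t _ _ _ (by omega) (fun y _ => z y), z]
    refine upd_ne G t f3 b g4 hb ?_ (h4 g4)
    have : nsum G f3 g4 ≤ b := by
      unfold nsum
      calc _ ≤ ∑ y, f3 y := Finset.sum_le_sum_of_subset (Finset.filter_subset _ _)
        _ = b := by simp [F3]
        _ ≤ b := le_rfl
    omega
  have F2 : ∀ v, f2 v = if v = g1 ∨ v = g2 then a else 0 := by
    intro v
    rw [h2, upd_far G t _ _ _ (by omega), F1]
    · by_cases h : v = g1 <;> by_cases h' : v = g2 <;> simp [h, h']
    · intro y hy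
      rw [F1, if_neg]
      rintro rfl; exact hna hy
  have n31 : g3 ≠ g1 := by
    rintro rfl; rw [F2] at e3; simp at e3; omega
  have n32 : g3 ≠ g2 := by
    rintro rfl; rw [F2] at e3; simp at e3; omega
  refine ⟨hne, hna, ?_⟩
  by_cases a1 : G.Adj g3 g1
  · have F3 : ∀ v, f3 v = if v = g3 ∨ G.Adj g3 v then 0 else f2 v := fun v => by
      rw [h3, upd_clear G t _ _ _ g1 a1 (by rw [F2]; simp; omega)]
    by_cases a2 : G.Adj g3 g2
    · exfalso
      have z : ∀ v, f3 v = 0 := by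
        intro v
        rw [F3, F2]
        split_ifs with h h'
        · rfl
        · rcases h' with rfl | rfl <;> tauto
        · rfl
      refine upd_ne G t f3 b g4 hb ?_ (h4 g4)
      rw [nsum_zero G f3 g4 (fun y _ => z y)]; omega
    · refine Or.inr (Or.inl ⟨a1, a2, adj_of_clear G t _ _ _ _ e4 ?_ (h4 _)⟩)
      rw [F3, F2]; simp [n32.symm, a2]; omega
  · by_cases a2 : G.Adj g3 g2
    · have F3 : ∀ v, f3 v = if v = g3 ∨ G.Adj g3 v then 0 else f2 v := fun v => by
        rw [h3, upd_clear G t _ _ _ g2 a2 (by rw [F2]; simp; omega)]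
      refine Or.inr (Or.inr ⟨a2, a1, adj_of_clear G t _ _ _ _ e4 ?_ (h4 _)⟩)
      rw [F3, F2]; simp [n31.symm, a1]; omega
    · have F3 : ∀ v, f3 v = if v = g3 then b else f2 v := fun v => by
        rw [h3, upd_far G t _ _ _ (by omega)]
        intro y hy
        rw [F2, if_neg]
        rintro (rfl | rfl) <;> contradiction
      refine Or.inl ⟨n31, n32, ?_, ?_, ?_⟩ <;>
        refine adj_of_clear G t _ _ _ _ e4 ?_ (h4 _) <;> rw [F3] <;> simp [F2, n31.symm, n32.symm]
          <;> omega

end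

def code : SpiderV → ℕ
  | .x => 0
  | .s1 => 1
  | .s2 => 2
  | .la i => 3 + i.val
  | .lb i => 6 + i.val

theorem code_lt (v : SpiderV) : code v < 9 := by
  rcases v with _ | _ | _ | i | i <;> simp [code] <;> omega

theorem code_inj {u v : SpiderV} (h : code u = code v) : u = v := by
  rcases u with _ | _ | _ | i | i <;> rcases v with _ | _ | _ | j | j <;>
    simp [code] at h ⊢ <;> omega

def adjB (m n : ℕ) : Bool :=
  (Nat.beq m 0 && Nat.ble 1 n && Nat.ble n 5) || (Nat.beq n 0 && Nat.ble 1 m && Nat.ble m 5) ||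
  (Nat.ble 3 m && Nat.ble m 5 && Nat.beq n (m+3)) || (Nat.ble 3 n && Nat.ble n 5 && Nat.beq m (n+3))

theorem adj_code (u v : SpiderV) : spiderG.Adj u v ↔ adjB (code u) (code v) = true := by
  rcases u with _ | _ | _ | i | i <;> rcases v with _ | _ | _ | j | j <;>
    simp [spiderG, code, adjB] <;> omega


def all9 (f : ℕ → Bool) : Bool :=
  f 0 && (f 1 && (f 2 && (f 3 && (f 4 && (f 5 && (f 6 && (f 7 && f 8)))))))

theorem all9_spec {f : ℕ → Bool} (h : all9 f = true) (n : ℕ) (hn : n < 9) : f n = true := by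
  simp only [all9, Bool.and_eq_true] at h
  interval_cases n <;> tauto

def imp (a b : Bool) : Bool := match a with
  | true => b
  | false => true

theorem imp_spec {a b : Bool} (h : imp a b = true) (ha : a = true) : b = true := by
  subst ha; exact h

def nb (a b : ℕ) : Bool := !(Nat.beq a b)

def free (r1 r2 b1 b2 g : ℕ) : Bool := nb g r1 && (nb g r2 && (nb g b1 && nb g b2))

def goodR (r1 r2 : ℕ) : Bool :=
  (Nat.beq r1 0 && Nat.ble 6 r2) || (Nat.beq r2 0 && Nat.ble 6 r1)

def goodB (b1 b2 : ℕ) : Bool :=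
  (Nat.beq b1 1 && Nat.beq b2 2) || (Nat.beq b1 2 && Nat.beq b2 1)

def gcond (g1 g2 g3 g4 : ℕ) : Bool :=
  (nb g3 g1 && nb g3 g2 && adjB g4 g1 && adjB g4 g2 && adjB g4 g3) ||
     (adjB g3 g1 && !(adjB g3 g2) && adjB g4 g2) ||
     (adjB g3 g2 && !(adjB g3 g1) && adjB g4 g1)

def chk : Bool :=
  all9 fun r3 => all9 fun r1 => imp (adjB r3 r1) <|
  all9 fun r2 => imp (adjB r3 r2 && nb r1 r2) <|
  all9 fun b3 => all9 fun b1 => imp (adjB b3 b1 && free r1 r2 r3 r3 b1) <|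
  all9 fun b2 => imp (adjB b3 b2 && (nb b1 b2 && free r1 r2 r3 r3 b2)) <|
  imp (!(goodR r1 r2 && goodB b1 b2)) <|
  all9 fun g1 => imp (free r1 r2 b1 b2 g1) <|
  all9 fun g2 => imp (free r1 r2 b1 b2 g2 && (nb g1 g2 && !(adjB g2 g1))) <|
  all9 fun g3 => imp (free r1 r2 b1 b2 g3) <|
  all9 fun g4 => imp (free r1 r2 b1 b2 g4) (!(gcond g1 g2 g3 g4))

set_option maxRecDepth 100000 in
theorem chk_true : chk = true := by decide +kernel

theorem nb_code {u v : SpiderV} (h : u ≠ v) : nb (code u) (code v) = true := by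
  have : code u ≠ code v := fun e => h (code_inj e)
  have h2 : Nat.beq (code u) (code v) = false := by
    rw [← Bool.not_eq_true, Nat.beq_eq]; exact this
  simp [nb, h2]

theorem free_code {r1 r2 b1 b2 g : SpiderV} (h1 : g ≠ r1) (h2 : g ≠ r2) (h3 : g ≠ b1)
    (h4 : g ≠ b2) : free (code r1) (code r2) (code b1) (code b2) (code g) = true := by
  simp [free, nb_code, *]

theorem combi (r1 r2 r3 b1 b2 b3 g1 g2 g3 g4 : SpiderV)
    (h1 : spiderG.Adj r3 r1) (h2 : spiderG.Adj r3 r2) (h3 : r1 ≠ r2)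
    (k1 : spiderG.Adj b3 b1) (k2 : spiderG.Adj b3 b2) (k3 : b1 ≠ b2)
    (l1 : b1 ≠ r1) (l2 : b1 ≠ r2) (l3 : b1 ≠ r3) (m1 : b2 ≠ r1) (m2 : b2 ≠ r2) (m3 : b2 ≠ r3)
    (G1 : g1 ≠ r1 ∧ g1 ≠ r2 ∧ g1 ≠ b1 ∧ g1 ≠ b2)
    (G2 : g2 ≠ r1 ∧ g2 ≠ r2 ∧ g2 ≠ b1 ∧ g2 ≠ b2)
    (G3 : g3 ≠ r1 ∧ g3 ≠ r2 ∧ g3 ≠ b1 ∧ g3 ≠ b2)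
    (G4 : g4 ≠ r1 ∧ g4 ≠ r2 ∧ g4 ≠ b1 ∧ g4 ≠ b2)
    (hg : g1 ≠ g2 ∧ ¬ spiderG.Adj g2 g1 ∧
    ((g3 ≠ g1 ∧ g3 ≠ g2 ∧ spiderG.Adj g4 g1 ∧ spiderG.Adj g4 g2 ∧ spiderG.Adj g4 g3) ∨
     (spiderG.Adj g3 g1 ∧ ¬ spiderG.Adj g3 g2 ∧ spiderG.Adj g4 g2) ∨
     (spiderG.Adj g3 g2 ∧ ¬ spiderG.Adj g3 g1 ∧ spiderG.Adj g4 g1))) :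
    ∃ i, ((r1 = .x ∧ r2 = .lb i) ∨ (r2 = .x ∧ r1 = .lb i)) ∧
      ((b1 = .s1 ∧ b2 = .s2) ∨ (b2 = .s1 ∧ b1 = .s2)) := by
  have key : (goodR (code r1) (code r2) && goodB (code b1) (code b2)) = true := by
    by_contra hbad
    have c := chk_true
    unfold chk at c
    simp only [adj_code] at h1 h2 k1 k2 hg
    obtain ⟨q1, q2, q3⟩ := hg
    have c := imp_spec (all9_spec (all9_spec c _ (code_lt r3)) _ (code_lt r1)) h1
    have c := imp_spec (all9_spec c _ (code_lt r2)) (by simp [h2, nb_code h3])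
    have c := imp_spec (all9_spec (all9_spec c _ (code_lt b3)) _ (code_lt b1))
      (by rw [k1, free_code l1 l2 l3 l3]; rfl)
    have c := imp_spec (all9_spec c _ (code_lt b2))
      (by rw [k2, free_code m1 m2 m3 m3, nb_code k3]; rfl)
    have c := imp_spec c (by rw [Bool.not_eq_true] at hbad; rw [hbad]; rfl)
    have c := imp_spec (all9_spec c _ (code_lt g1)) (free_code G1.1 G1.2.1 G1.2.2.1 G1.2.2.2)
    have c := imp_spec (all9_spec c _ (code_lt g2))
      (by rw [free_code G2.1 G2.2.1 G2.2.2.1 G2.2.2.2, nb_code q1]; simpa using q2)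
    have c := imp_spec (all9_spec c _ (code_lt g3)) (free_code G3.1 G3.2.1 G3.2.2.1 G3.2.2.2)
    have c := imp_spec (all9_spec c _ (code_lt g4)) (free_code G4.1 G4.2.1 G4.2.2.1 G4.2.2.2)
    have d : gcond (code g1) (code g2) (code g3) (code g4) = true := by
      unfold gcond
      rcases q3 with ⟨a1, a2, a3, a4, a5⟩ | ⟨a1, a2, a3⟩ | ⟨a1, a2, a3⟩
      · simp [nb_code a1, nb_code a2, a3, a4, a5]
      · simp [a1, a2, a3]
      · simp [a1, a2, a3]
    rw [d] at c
    exact absurd c (by decide)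
  rw [Bool.and_eq_true] at key
  obtain ⟨kr, kb⟩ := key
  have B : ((b1 = .s1 ∧ b2 = .s2) ∨ (b2 = .s1 ∧ b1 = .s2)) := by
    simp [goodB] at kb
    rcases kb with ⟨e1, e2⟩ | ⟨e1, e2⟩
    · exact Or.inl ⟨code_inj e1, code_inj e2⟩
    · exact Or.inr ⟨code_inj e2, code_inj e1⟩
  have L : ∀ v, 6 ≤ code v → ∃ i, v = .lb i := by
    intro v hv
    rcases v with _ | _ | _ | i | i
    · simp [code] at hv
    · simp [code] at hv
    · simp [code] at hv
    · simp [code] at hv; omega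
    · exact ⟨i, rfl⟩
  simp [goodR] at kr
  rcases kr with ⟨e1, e2⟩ | ⟨e1, e2⟩
  · obtain ⟨i, hi⟩ := L _ e2
    exact ⟨i, Or.inl ⟨code_inj e1, hi⟩, B⟩
  · obtain ⟨i, hi⟩ := L _ e2
    exact ⟨i, Or.inr ⟨code_inj e1, hi⟩, B⟩

/-- all stacks on the board have a color in `P` and positive height -/
def Okc {V C : Type*} (P : C → Prop) (δ : Config V C) : Prop :=
  ∀ v c h, δ v = some (c, h) → P c ∧ 0 < h

theorem Okc_place {V C : Type*} [Fintype V] (G : SimpleGraph V) (t : ℕ) (P : C → Prop)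
    (δ : Config V C) (c : C) (k : ℕ) (x : V) (h : Okc P δ) (hc : P c) (hk : 0 < k) :
    Okc P (place G t δ (c, k) x) := by
  intro v c' h' e
  unfold place at e
  split_ifs at e with h1 h2 h3
  · simp at e
    obtain ⟨rfl, rfl⟩ := e
    exact ⟨hc, by omega⟩
  · exact h v c' h' e

theorem ch_some {V C : Type*} {δ : Config V C} {c : C} {v : V} {k : ℕ} (h : ch δ c v = k)
    (hk : 0 < k) : δ v = some (c, k) := by
  unfold ch colorHeight at h
  rcases e : δ v with _ | ⟨c', h'⟩
  · rw [e] at h; simp at h; omega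
  · rw [e] at h
    by_cases hc : c' = c
    · simp [hc] at h ⊢; exact h
    · simp [hc] at h; omega

end Hexasort

namespace Hexasort
/-- in any emptying placement of
`S' = S_initial + S_reservation + S_black + S_connector` on the nine-vertex spider,
after the first eight stacks the center `x` and some leaf `lb i` hold red stacks of
height `t−1`, the vertices `s1` and `s2` hold blue stacks of height `t−1`, and all
other vertices are empty. -/
theorem statement_4 {C : Type*} (red blue green black : C)
    (hrb : red ≠ blue) (hrg : red ≠ green) (hbg : blue ≠ green)
    (hkr : black ≠ red) (hkb : black ≠ blue) (hkg : black ≠ green)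
    (t : ℕ) (ht : 4 ≤ t)
    (heights : List ℕ) (hpos : ∀ h ∈ heights, 1 ≤ h)
    (S' : List (C × ℕ))
    (hS' : S' = Sinitial red blue t ++ Sreservation green t ++
      heights.map (fun h => (black, h)) ++ Sconnector red blue t)
    (p : List SpiderV)
    (hleg : Legal spiderG t (emptyConfig SpiderV C) S' p)
    (hemp : play spiderG t (emptyConfig SpiderV C) S' p = emptyConfig SpiderV C) :
    ∃ i : Fin 3, ∀ δ8 : Config SpiderV C,
      δ8 = play spiderG t (emptyConfig SpiderV C) (S'.take 8) (p.take 8) →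
      δ8 SpiderV.x = some (red, t-1) ∧
      δ8 (SpiderV.lb i) = some (red, t-1) ∧
      δ8 SpiderV.s1 = some (blue, t-1) ∧
      δ8 SpiderV.s2 = some (blue, t-1) ∧
      (∀ v : SpiderV, v ≠ SpiderV.x → v ≠ SpiderV.lb i →
        v ≠ SpiderV.s1 → v ≠ SpiderV.s2 → δ8 v = none) := by
  obtain ⟨p8, q, hp, hl8, L8, Lq, hplay⟩ := legal_append spiderG t
    (Sinitial red blue t ++ Sreservation green t)
    (heights.map (fun h => (black, h)) ++ Sconnector red blue t) _ p (by
      rw [hS'] at hleg; simpa only [List.append_assoc] using hleg)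
  have hfin : play spiderG t (play spiderG t (emptyConfig SpiderV C)
      (Sinitial red blue t ++ Sreservation green t) p8)
      (heights.map (fun h => (black, h)) ++ Sconnector red blue t) q = emptyConfig SpiderV C := by
    rw [← hplay]; rw [hS'] at hemp; simpa only [List.append_assoc] using hemp
  have htake : play spiderG t (emptyConfig SpiderV C) (S'.take 8) (p.take 8) =
      play spiderG t (emptyConfig SpiderV C) (Sinitial red blue t ++ Sreservation green t) p8 := by
    have e1 : S'.take 8 = Sinitial red blue t ++ Sreservation green t := by
      rw [hS']; simp [Sinitial, Sreservation]
    have e2 : p.take 8 = p8 := by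
      rw [hp]; exact List.take_left' (by rw [hl8]; rfl)
    rw [e1, e2]
  rw [htake]
  clear htake hplay hp hleg hemp hS'
  obtain ⟨pk, q2, -, -, Lk, L2, hplay2⟩ := legal_append spiderG t _ _ _ _ Lq
  rw [hplay2] at hfin
  have hR := ch_black spiderG t black red hkr heights _ _ Lk
  have hGr := ch_black spiderG t black green hkg heights _ _ Lk
  have hB := ch_black spiderG t black blue hkb heights _ _ Lk
  generalize play spiderG t (play spiderG t (emptyConfig SpiderV C)
      (Sinitial red blue t ++ Sreservation green t) p8)
      (heights.map (fun h => (black, h))) pk = δk at *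
  clear Lq hplay2 Lk
  simp only [Sinitial, Sreservation, Sconnector, List.cons_append, List.nil_append] at *
  rcases L8 with _ | ⟨_, _, r1, _, x1, L8⟩
  rcases L8 with _ | ⟨_, _, r2, _, x2, L8⟩
  rcases L8 with _ | ⟨_, _, b1, _, y1, L8⟩
  rcases L8 with _ | ⟨_, _, b2, _, y2, L8⟩
  rcases L8 with _ | ⟨_, _, g1, _, z1, L8⟩
  rcases L8 with _ | ⟨_, _, g2, _, z2, L8⟩
  rcases L8 with _ | ⟨_, _, g3, _, z3, L8⟩
  rcases L8 with _ | ⟨_, _, g4, _, z4, L8⟩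
  rcases L8 with _ | _
  rcases L2 with _ | ⟨_, _, r3, _, x3, L2⟩
  rcases L2 with _ | ⟨_, _, b3, _, y3, L2⟩
  rcases L2 with _ | _
  simp only [play] at *
  have hch0 : ∀ c : C, ch (emptyConfig SpiderV C) c = 0 := fun c => rfl
  have ok0 : Okc (fun c => c = red ∨ c = blue ∨ c = green) (emptyConfig SpiderV C) := by
    intro v c h e; simp [emptyConfig] at e
  generalize emptyConfig SpiderV C = δ0 at *
  have hch9 := hch0
  rw [← hfin] at hch9
  generalize hd1 : place spiderG t δ0 (red, t-1) r1 = δ1 at *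
  generalize hd2 : place spiderG t δ1 (red, t-1) r2 = δ2 at *
  generalize hd3 : place spiderG t δ2 (blue, t-1) b1 = δ3 at *
  generalize hd4 : place spiderG t δ3 (blue, t-1) b2 = δ4 at *
  generalize hd5 : place spiderG t δ4 (green, t/2+1) g1 = δ5 at *
  generalize hd6 : place spiderG t δ5 (green, t/2+1) g2 = δ6 at *
  generalize hd7 : place spiderG t δ6 (green, (t+1)/2-1) g3 = δ7 at *
  generalize hd8 : place spiderG t δ7 (green, (t+1)/2-1) g4 = δ8 at *
  generalize hd9 : place spiderG t δk (red, t-1) r3 = δ9 at *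
  have ok1 := Okc_place spiderG t _ _ red (t-1) r1 ok0 (by simp) (by omega)
  rw [hd1] at ok1
  have ok2 := Okc_place spiderG t _ _ red (t-1) r2 ok1 (by simp) (by omega)
  rw [hd2] at ok2
  have ok3 := Okc_place spiderG t _ _ blue (t-1) b1 ok2 (by simp) (by omega)
  rw [hd3] at ok3
  have ok4 := Okc_place spiderG t _ _ blue (t-1) b2 ok3 (by simp) (by omega)
  rw [hd4] at ok4
  have ok5 := Okc_place spiderG t _ _ green (t/2+1) g1 ok4 (by simp) (by omega)
  rw [hd5] at ok5
  have ok6 := Okc_place spiderG t _ _ green (t/2+1) g2 ok5 (by simp) (by omega)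
  rw [hd6] at ok6
  have ok7 := Okc_place spiderG t _ _ green ((t+1)/2-1) g3 ok6 (by simp) (by omega)
  rw [hd7] at ok7
  have ok8 := Okc_place spiderG t _ _ green ((t+1)/2-1) g4 ok7 (by simp) (by omega)
  rw [hd8] at ok8
  have same := fun δ c k v => ch_place_same (C := C) spiderG t δ c k v
  have diff := fun δ c c' hc k v => ch_place_diff (C := C) spiderG t δ c c' hc k v
  -- red
  have R1 : ch δ1 red = upd spiderG t 0 (t-1) r1 := by rw [← hd1, same, hch0]
  have R2 : ch δ2 red = upd spiderG t (upd spiderG t 0 (t-1) r1) (t-1) r2 := by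
    rw [← hd2, same, R1]
  have R3 : ch δ3 red = ch δ2 red := by rw [← hd3]; exact diff _ _ _ hrb.symm _ _ y1
  have R4 : ch δ4 red = ch δ2 red := by rw [← hd4, ← R3]; exact diff _ _ _ hrb.symm _ _ y2
  have R5 : ch δ5 red = ch δ2 red := by rw [← hd5, ← R4]; exact diff _ _ _ hrg.symm _ _ z1
  have R6 : ch δ6 red = ch δ2 red := by rw [← hd6, ← R5]; exact diff _ _ _ hrg.symm _ _ z2
  have R7 : ch δ7 red = ch δ2 red := by rw [← hd7, ← R6]; exact diff _ _ _ hrg.symm _ _ z3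
  have R8 : ch δ8 red = ch δ2 red := by rw [← hd8, ← R7]; exact diff _ _ _ hrg.symm _ _ z4
  have Rk : ch δk red = ch δ2 red := by rw [hR, R8]
  have R9 : ch δ9 red = upd spiderG t (ch δ2 red) (t-1) r3 := by rw [← hd9, same, Rk]
  have R10 : ch δ9 red = 0 := by
    rw [← hch9 red]; exact (diff _ _ _ hrb.symm _ _ y3).symm
  obtain ⟨rne, -, ra1, ra2, rf⟩ := triple spiderG t ht r1 r2 r3 (ch δ2 red) R2
    (by rw [← R1]; exact ch_none x2 _) (by rw [← Rk]; exact ch_none x3 _)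
    (by intro v; rw [← R9, R10]; rfl)
  -- blue
  have B2 : ch δ2 blue = 0 := by
    rw [← hd2, diff _ _ _ hrb _ _ x2, ← hd1]
    rw [diff _ _ _ hrb _ _ x1, hch0]
  have B3 : ch δ3 blue = upd spiderG t 0 (t-1) b1 := by rw [← hd3, same, B2]
  have B4 : ch δ4 blue = upd spiderG t (upd spiderG t 0 (t-1) b1) (t-1) b2 := by
    rw [← hd4, same, B3]
  have B5 : ch δ5 blue = ch δ4 blue := by rw [← hd5]; exact diff _ _ _ hbg.symm _ _ z1
  have B6 : ch δ6 blue = ch δ4 blue := by rw [← hd6, ← B5]; exact diff _ _ _ hbg.symm _ _ z2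
  have B7 : ch δ7 blue = ch δ4 blue := by rw [← hd7, ← B6]; exact diff _ _ _ hbg.symm _ _ z3
  have B8 : ch δ8 blue = ch δ4 blue := by rw [← hd8, ← B7]; exact diff _ _ _ hbg.symm _ _ z4
  have Bk : ch δk blue = ch δ4 blue := by rw [hB, B8]
  have B9 : ch δ9 blue = ch δ4 blue := by rw [← hd9, ← Bk]; exact diff _ _ _ hrb _ _ x3
  have B10 : upd spiderG t (ch δ4 blue) (t-1) b3 = 0 := by rw [← hch9 blue, same, B9]
  obtain ⟨bne, -, ba1, ba2, bf⟩ := triple spiderG t ht b1 b2 b3 (ch δ4 blue) B4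
    (by rw [← B3]; exact ch_none y2 _) (by rw [← B9]; exact ch_none y3 _)
    (by intro v; rw [B10]; rfl)
  -- green
  have G4 : ch δ4 green = 0 := by
    rw [← hd4, diff _ _ _ hbg _ _ y2, ← hd3, diff _ _ _ hbg _ _ y1, ← hd2,
      diff _ _ _ hrg _ _ x2, ← hd1]
    rw [diff _ _ _ hrg _ _ x1, hch0]
  have G8 : ch δ8 green = 0 := by
    rw [← hGr, ← hch9 green, diff _ _ _ hbg _ _ y3, ← hd9]
    exact (diff _ _ _ hrg _ _ x3).symm
  have hgr := greens spiderG t (t/2+1) ((t+1)/2-1) (by omega) (by omega) (by omega) g1 g2 g3 g4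
    (ch δ5 green) (ch δ6 green) (ch δ7 green) (by rw [← hd5, same, G4]) (by rw [← hd6, same])
    (by rw [← hd7, same]) (by intro v; rw [← same, hd8, G8]; rfl)
    (ch_none z2 _) (ch_none z3 _) (ch_none z4 _)
  have nr : ∀ (δ : Config SpiderV C) v, ch δ red = ch δ2 red → δ v = none → v ≠ r1 ∧ v ≠ r2 := by
    intro δ v h e
    have h1 := ch_none e red
    rw [h, rf] at h1
    constructor <;> rintro rfl <;> simp at h1 <;> omega
  have nbl : ∀ (δ : Config SpiderV C) v, ch δ blue = ch δ4 blue → δ v = none →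
      v ≠ b1 ∧ v ≠ b2 := by
    intro δ v h e
    have h1 := ch_none e blue
    rw [h, bf] at h1
    constructor <;> rintro rfl <;> simp at h1 <;> omega
  have c1 := nr _ _ rfl y1
  have c2 := nr _ _ R3 y2
  have c3 := nbl _ _ Bk x3
  have comb : ∀ (δ : Config SpiderV C) v, ch δ red = ch δ2 red → ch δ blue = ch δ4 blue →
      δ v = none → v ≠ r1 ∧ v ≠ r2 ∧ v ≠ b1 ∧ v ≠ b2 := fun δ v h h' e =>
    ⟨(nr δ v h e).1, (nr δ v h e).2, (nbl δ v h' e).1, (nbl δ v h' e).2⟩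
  obtain ⟨i, hi, hb⟩ := combi r1 r2 r3 b1 b2 b3 g1 g2 g3 g4 ra1 ra2 rne ba1 ba2 bne
    c1.1 c1.2 c3.1.symm c2.1 c2.2 c3.2.symm (comb _ _ R4 rfl z1) (comb _ _ R5 B5 z2)
    (comb _ _ R6 B6 z3) (comb _ _ R7 B7 z4) hgr
  refine ⟨i, ?_⟩
  intro δ' hδ'
  subst hδ'
  have t1 : 0 < t - 1 := by omega
  refine ⟨ch_some ?_ t1, ch_some ?_ t1, ch_some ?_ t1, ch_some ?_ t1, ?_⟩
  · rw [R8, rf, if_pos]; rcases hi with h | h <;> simp [h]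
  · rw [R8, rf, if_pos]; rcases hi with h | h <;> simp [h]
  · rw [B8, bf, if_pos]; rcases hb with h | h <;> simp [h]
  · rw [B8, bf, if_pos]; rcases hb with h | h <;> simp [h]
  · intro v v1 v2 v3 v4
    rcases e : δ' v with _ | ⟨c, h⟩
    · rfl
    · exfalso
      obtain ⟨hc, hh⟩ := ok8 _ _ _ e
      have e1 : ch δ' c v = h := by simp [ch, e, colorHeight]
      rcases hc with rfl | rfl | rfl
      · rw [R8, rf, if_neg] at e1
        · omega
        · rcases hi with ⟨h, h'⟩ | ⟨h, h'⟩ <;> simp [h, h', v1, v2]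
      · rw [B8, bf, if_neg] at e1
        · omega
        · rcases hb with ⟨h, h'⟩ | ⟨h, h'⟩ <;> simp [h, h', v3, v4]
      · rw [G8] at e1
        simp at e1; omega

end Hexasort
end

section
/- In the 3-Partition-derived Hexasort instance (G, S, t) on m disjoint gadget copies, every placement of S that empties the board satisfies the following at the configuration reached after placing S_initial (the first 6m stacks): in each gadget copy there is some i ∈ {1,2,3,4} such that the vertices ℓ_a^i and ℓ_b^j for all j ≠ i are empty, the center x and the leaf ℓ_b^i hold stacks of the same color, the vertex s and the three vertices ℓ_a^j for j ≠ i are occupied, and the six stacks placed on the gadget use exactly three colors (each of these three colors having both of its two stacks within that gadget). -/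
open scoped Classical

namespace Hexasort

/-- The vertices of the ten-vertex gadget graph `H`: a center `x`, a leaf `s` adjacent
to the center, and four arms `x – la i – lb i` for `i ∈ {0,1,2,3}`. -/
inductive GadgetV : Type
  | x | s | la : Fin 4 → GadgetV | lb : Fin 4 → GadgetV
  deriving DecidableEq, Fintype

/-- The base (asymmetric) adjacency relation of the gadget graph `H`. -/
def gadgetRel : GadgetV → GadgetV → Prop := fun u v =>
  (u = .x ∧ v = .s) ∨ (∃ i, u = .x ∧ v = .la i) ∨ (∃ i, u = .la i ∧ v = .lb i)

/-- The disjoint union of `m` copies of the gadget graph `H`. -/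
def disjointGadgets (m : ℕ) : SimpleGraph (Fin m × GadgetV) :=
  SimpleGraph.fromRel (fun u v => u.1 = v.1 ∧ gadgetRel u.2 v.2)

/-- Colors for the 3-Partition reduction: `some (j, 0/1/2)` are `red_j`, `blue_j`,
`green_j`, and `none` is the color black. -/
abbrev GColor (m : ℕ) := Option (Fin m × Fin 3)

/-- `S_initial`: for each gadget `j`, two stacks of height `t−1` of each of the three
gadget colors `red_j, blue_j, green_j`. -/
def SinitialG (m t : ℕ) : List (GColor m × ℕ) :=
  (List.finRange m).flatMap (fun j =>
    [(some (j, 0), t-1), (some (j, 0), t-1), (some (j, 1), t-1),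
     (some (j, 1), t-1), (some (j, 2), t-1), (some (j, 2), t-1)])

/-- `S_A`: the black stacks encoding the 3-Partition input values. -/
def SAG (m : ℕ) (a : Fin (3*m) → ℕ) : List (GColor m × ℕ) :=
  (List.finRange (3*m)).map (fun i => ((none : GColor m), a i))

/-- `S_connector`: for each gadget `j`, one stack of height `t−1` of each gadget color. -/
def SconnectorG (m t : ℕ) : List (GColor m × ℕ) :=
  (List.finRange m).flatMap (fun j =>
    [(some (j, 0), t-1), (some (j, 1), t-1), (some (j, 2), t-1)])

/-- `S_final`: for each gadget, four black stacks of height `1`. -/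
def SfinalG (m : ℕ) : List (GColor m × ℕ) :=
  (List.finRange m).flatMap (fun _ =>
    [((none : GColor m), 1), (none, 1), (none, 1), (none, 1)])

/-- The full stack sequence `S = S_initial + S_A + S_connector + S_final`. -/
def SfullG (m : ℕ) (a : Fin (3*m) → ℕ) (t : ℕ) : List (GColor m × ℕ) :=
  SinitialG m t ++ SAG m a ++ SconnectorG m t ++ SfinalG m

end Hexasort

namespace Hexasort

theorem place_other {V C : Type*} [Fintype V] (G : SimpleGraph V) (t : ℕ)
    (δ : Config V C) (s : C × ℕ) (x : V) (hx : δ x = none) (c : C) (hc : s.1 ≠ c) (v : V) (h : ℕ) :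
    place G t δ s x v = some (c, h) ↔ δ v = some (c, h) := by
  unfold place
  by_cases hv : v = x
  · subst hv
    rw [if_pos rfl, hx]
    split_ifs <;> simp [hc]
  · rw [if_neg hv]
    split_ifs with h1
    · obtain ⟨_, hh, e⟩ := h1
      rw [e]; simp [hc]
    · rfl

theorem place_same {V C : Type*} [Fintype V] (G : SimpleGraph V) (t : ℕ)
    (δ : Config V C) (s : C × ℕ) (x : V) (v : V) (hv : v ≠ x) (h : ℕ) :
    place G t δ s x v = some (s.1, h) ↔ δ v = some (s.1, h) ∧ ¬ G.Adj x v := by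
  unfold place
  rw [if_neg hv]
  split_ifs with h1
  · simp [h1.1]
  · constructor
    · intro e
      exact ⟨e, fun ha => h1 ⟨ha, h, e⟩⟩
    · exact fun e => e.1

theorem place_self_zero {V C : Type*} [Fintype V] (G : SimpleGraph V) (t : ℕ)
    (δ : Config V C) (s : C × ℕ) (x : V) (hs : s.2 < t)
    (hn : ∀ y, G.Adj x y → ∀ h, δ y ≠ some (s.1, h)) :
    place G t δ s x x = some s := by
  have h0 : neighborSum G δ s.1 x = 0 := by
    unfold neighborSum
    apply Finset.sum_eq_zero
    intro y hy
    have hy' : G.Adj x y := by simpa using hy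
    unfold colorHeight
    rcases hd : δ y with _ | ⟨c', h'⟩
    · rfl
    · simp only
      rw [if_neg]
      rintro rfl
      exact hn y hy' h' hd
  unfold place
  rw [if_pos rfl, h0, if_neg (by omega)]
  rfl

theorem place_self_clear {V C : Type*} [Fintype V] (G : SimpleGraph V) (t : ℕ)
    (δ : Config V C) (s : C × ℕ) (x y : V) (h : ℕ) (ha : G.Adj x y)
    (hy : δ y = some (s.1, h)) (ht : t ≤ s.2 + h) :
    place G t δ s x x = none := by
  have h0 : h ≤ neighborSum G δ s.1 x := by
    unfold neighborSum
    have := Finset.single_le_sum (f := fun y => colorHeight (δ y) s.1)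
      (s := Finset.univ.filter (fun y => G.Adj x y)) (fun _ _ => Nat.zero_le _)
      (a := y) (by simpa using ha)
    simpa [colorHeight, hy] using this
  unfold place
  rw [if_pos rfl, if_pos (by omega)]

theorem frame {V C : Type*} [Fintype V] (G : SimpleGraph V) (t N : ℕ)
    (conf : ℕ → Config V C) (st : ℕ → C × ℕ) (w : ℕ → V)
    (hstep : ∀ n < N, conf n (w n) = none ∧ conf (n+1) = place G t (conf n) (st n) (w n))
    (c : C) (a b : ℕ) (hab : a ≤ b) (hb : b ≤ N) (hc : ∀ n, a ≤ n → n < b → (st n).1 ≠ c)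
    (v : V) (h : ℕ) : conf b v = some (c, h) ↔ conf a v = some (c, h) := by
  induction b, hab using Nat.le_induction with
  | base => rfl
  | succ b hab ih =>
    rw [← ih (by omega) (fun n h1 h2 => hc n h1 (by omega)), (hstep b (by omega)).2]
    exact place_other G t _ _ _ (hstep b (by omega)).1 c (hc b hab (by omega)) v h

theorem core {V C : Type*} [Fintype V] (G : SimpleGraph V) (t N : ℕ)
    (conf : ℕ → Config V C) (st : ℕ → C × ℕ) (w : ℕ → V)
    (h0 : conf 0 = emptyConfig V C) (hN : conf N = emptyConfig V C)
    (hstep : ∀ n < N, conf n (w n) = none ∧ conf (n+1) = place G t (conf n) (st n) (w n))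
    (c : C) (k n1 n2 n3 : ℕ) (h12 : n1 < n2) (h23 : n2 < n3) (h3 : n3 < N)
    (hk : k < t) (hk2 : t ≤ k + k)
    (e1 : st n1 = (c, k)) (e2 : st n2 = (c, k)) (e3 : st n3 = (c, k))
    (hc : ∀ n < N, (st n).1 = c → n = n1 ∨ n = n2 ∨ n = n3) :
    w n1 ≠ w n2 ∧ G.Adj (w n3) (w n1) ∧ G.Adj (w n3) (w n2) ∧
    ∀ n, n2 < n → n ≤ n3 → ∀ v h, conf n v = some (c, h) ↔ (v = w n1 ∨ v = w n2) ∧ h = k := by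
  have fr := frame G t N conf st w hstep c
  have a1 : ∀ v h, conf n1 v ≠ some (c, h) := by
    intro v h e
    rw [fr 0 n1 (by omega) (by omega) (fun n _ h2 e => by have := hc n (by omega) e; omega), h0] at e
    simp [emptyConfig] at e
  have a4 : ∀ v h, conf (n3+1) v ≠ some (c, h) := by
    intro v h e
    rw [← fr (n3+1) N (by omega) (by omega)
      (fun n _ h2 e => by have := hc n (by omega) e; omega), hN] at e
    simp [emptyConfig] at e
  have s1 := (hstep n1 (by omega)).2
  have s2 := (hstep n2 (by omega)).2
  have s3 := (hstep n3 (by omega)).2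
  have z1 := (hstep n1 (by omega)).1
  have z2 := (hstep n2 (by omega)).1
  have z3 := (hstep n3 (by omega)).1
  rw [e1] at s1; rw [e2] at s2; rw [e3] at s3
  have a2 : ∀ v h, conf n2 v = some (c, h) ↔ v = w n1 ∧ h = k := by
    intro v h
    rw [fr (n1+1) n2 (by omega) (by omega)
      (fun n _ h2 e => by have := hc n (by omega) e; omega), s1]
    by_cases hv : v = w n1
    · subst hv
      rw [place_self_zero G t _ (c,k) _ hk (fun y _ h => a1 y h)]
      simp [eq_comm]
    · rw [place_same G t _ (c,k) _ _ hv]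
      simp [hv, a1]
  have a2' := (a2 (w n1) k).2 ⟨rfl, rfl⟩
  have hne : w n1 ≠ w n2 := by
    intro e; rw [e, z2] at a2'; simp at a2'
  have hnadj : ¬ G.Adj (w n2) (w n1) := by
    intro ha
    have b : ∀ v h, conf n3 v ≠ some (c, h) := by
      intro v h e
      rw [fr (n2+1) n3 (by omega) (by omega)
        (fun n _ h2 e => by have := hc n (by omega) e; omega), s2] at e
      by_cases hv : v = w n2
      · subst hv
        rw [place_self_clear G t _ (c,k) _ _ k ha a2' hk2] at e
        simp at e
      · rw [place_same G t _ (c,k) _ _ hv, a2] at e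
        obtain ⟨⟨rfl, _⟩, h2⟩ := e
        exact h2 ha
    have := place_self_zero G t (conf n3) (c,k) (w n3) hk (fun y _ h => b y h)
    rw [← s3] at this
    exact a4 _ _ this
  have a3 : ∀ n, n2 < n → n ≤ n3 → ∀ v h,
      conf n v = some (c, h) ↔ (v = w n1 ∨ v = w n2) ∧ h = k := by
    intro n hn hn' v h
    rw [fr (n2+1) n (by omega) (by omega)
      (fun n _ h2 e => by have := hc n (by omega) e; omega), s2]
    by_cases hv : v = w n2
    · subst hv
      rw [place_self_zero G t _ (c,k) _ hk]
      · simp [eq_comm]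
      · intro y hy h e
        rw [a2] at e
        exact hnadj (e.1 ▸ hy)
    · rw [place_same G t _ (c,k) _ _ hv, a2]
      constructor
      · rintro ⟨⟨h1, h2⟩, _⟩
        exact ⟨Or.inl h1, h2⟩
      · rintro ⟨h1 | h1, h2⟩
        · exact ⟨⟨h1, h2⟩, h1 ▸ hnadj⟩
        · exact absurd h1 hv
  have key : ∀ u, (u = w n1 ∨ u = w n2) → G.Adj (w n3) u := by
    intro u hu
    by_contra hna
    have e := (a3 n3 h23 le_rfl u k).2 ⟨hu, rfl⟩
    have hv : u ≠ w n3 := by rintro rfl; rw [z3] at e; simp at e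
    have := (place_same G t (conf n3) (c,k) (w n3) u hv k).2 ⟨e, hna⟩
    rw [← s3] at this
    exact a4 _ _ this
  exact ⟨hne, key _ (Or.inl rfl), key _ (Or.inr rfl), a3⟩

theorem legal_steps {V C : Type*} [Fintype V] (G : SimpleGraph V) (t : ℕ)
    (δ : Config V C) (S : List (C × ℕ)) (p : List V) (hl : Legal G t δ S p) :
    p.length = S.length ∧ ∀ n s x, S[n]? = some s → p[n]? = some x →
      play G t δ (S.take n) (p.take n) x = none ∧
      play G t δ (S.take (n+1)) (p.take (n+1)) =
        place G t (play G t δ (S.take n) (p.take n)) s x := by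
  induction hl with
  | nil δ => simp
  | @cons δ s S x p h1 h2 ih =>
    refine ⟨by simp [ih.1], ?_⟩
    intro n s' x' hs hx
    cases n with
    | zero =>
      simp at hs hx
      subst hs; subst hx
      simp [play, h1]
    | succ n =>
      simp only [List.getElem?_cons_succ] at hs hx
      have := ih.2 n s' x' hs hx
      simpa [List.take_succ_cons, play] using this

theorem flatMap_get {α β : Type*} (f : α → List β) (k : ℕ) (hk : ∀ a, (f a).length = k)
    (l : List α) (i r : ℕ) (hr : r < k) :
    (l.flatMap f)[k*i+r]? = l[i]?.bind (fun a => (f a)[r]?) := by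
  induction l generalizing i with
  | nil => simp
  | cons a l ih =>
    rw [List.flatMap_cons]
    cases i with
    | zero =>
      rw [List.getElem?_append_left (by rw [hk]; omega)]
      simp
    | succ i =>
      rw [List.getElem?_append_right (by rw [hk]; nlinarith), hk]
      have : k * (i+1) + r - k = k*i+r := by rw [Nat.mul_succ]; omega
      rw [this, ih]
      simp

theorem flatMap_len {α β : Type*} (f : α → List β) (k : ℕ) (hk : ∀ a, (f a).length = k)
    (l : List α) : (l.flatMap f).length = k * l.length := by
  induction l with
  | nil => simp
  | cons a l ih => rw [List.flatMap_cons, List.length_append, ih, hk]; simp; ring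

theorem len_full (m : ℕ) (a : Fin (3*m) → ℕ) (t : ℕ) : (SfullG m a t).length = 16*m := by
  unfold SfullG SinitialG SAG SconnectorG SfinalG
  simp only [List.length_append, List.length_map, List.length_finRange]
  rw [flatMap_len _ 6 (by simp), flatMap_len _ 3 (by simp), flatMap_len _ 4 (by simp)]
  simp; ring

theorem len_init (m : ℕ) (t : ℕ) : (SinitialG m t).length = 6*m := by
  unfold SinitialG
  rw [flatMap_len _ 6 (by simp)]
  simp

theorem len_conn (m : ℕ) (t : ℕ) : (SconnectorG m t).length = 3*m := by
  unfold SconnectorG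
  rw [flatMap_len _ 3 (by simp)]
  simp

theorem get_init (m : ℕ) (a : Fin (3*m) → ℕ) (t : ℕ) (j : Fin m) (d : Fin 3) (e : Fin 2) :
    (SfullG m a t)[6*j.1+2*d.1+e.1]? = some (some (j,d), t-1) := by
  have hl := len_init m t
  unfold SfullG
  rw [List.getElem?_append_left (by simp only [List.length_append]; omega),
    List.getElem?_append_left (by simp only [List.length_append]; omega),
    List.getElem?_append_left (by omega)]
  unfold SinitialG
  rw [add_assoc, flatMap_get _ 6 (by simp) _ _ _ (by omega)]
  rw [List.getElem?_eq_getElem (by simp)]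
  fin_cases d <;> fin_cases e <;> simp

theorem get_conn (m : ℕ) (a : Fin (3*m) → ℕ) (t : ℕ) (j : Fin m) (d : Fin 3) :
    (SfullG m a t)[9*m+3*j.1+d.1]? = some (some (j,d), t-1) := by
  have hl := len_init m t
  have hl2 := len_conn m t
  have hl3 : (SAG m a).length = 3 * m := by simp [SAG]
  unfold SfullG
  rw [List.getElem?_append_left (by simp only [List.length_append]; omega),
    List.getElem?_append_right (by simp only [List.length_append]; omega)]
  have : 9*m+3*j.1+d.1 - (SinitialG m t ++ SAG m a).length = 3*j.1+d.1 := by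
    simp only [List.length_append]; omega
  rw [this]
  unfold SconnectorG
  rw [flatMap_get _ 3 (by simp) _ _ _ (by omega)]
  rw [List.getElem?_eq_getElem (by simp)]
  fin_cases d <;> simp

theorem color_cases (m : ℕ) (a : Fin (3*m) → ℕ) (t : ℕ) (n : ℕ) (s : GColor m × ℕ)
    (hs : (SfullG m a t)[n]? = some s) :
    (n < 6*m ∧ ∃ j d, ∃ e : Fin 2, s.1 = some (j,d) ∧ n = 6*j.1+2*d.1+e.1) ∨
    (6*m ≤ n ∧ (s.1 = none ∨ ∃ j d, s.1 = some (j,d) ∧ n = 9*m+3*j.1+d.1)) := by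
  have hl := len_init m t
  have hl2 := len_conn m t
  have hl3 : (SAG m a).length = 3 * m := by simp [SAG]
  by_cases h1 : n < 6*m
  · left
    refine ⟨h1, ⟨n/6, by omega⟩, ⟨(n%6)/2, by omega⟩, ⟨n%2, by omega⟩, ?_, by simp; omega⟩
    have := get_init m a t ⟨n/6, by omega⟩ ⟨(n%6)/2, by omega⟩ ⟨n%2, by omega⟩
    have h2 : 6 * (n/6) + 2 * ((n%6)/2) + n % 2 = n := by omega
    simp only [h2] at this
    rw [this] at hs
    rw [← Option.some.inj hs]
  · right
    refine ⟨by omega, ?_⟩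
    by_cases h2 : n < 9*m
    · left
      unfold SfullG at hs
      rw [List.getElem?_append_left (by simp only [List.length_append]; omega),
        List.getElem?_append_left (by simp only [List.length_append]; omega),
        List.getElem?_append_right (by omega)] at hs
      have := List.mem_of_getElem? hs
      simp only [SAG, List.mem_map] at this
      obtain ⟨_, _, rfl⟩ := this
      rfl
    · by_cases h3 : n < 12*m
      · right
        refine ⟨⟨(n-9*m)/3, by omega⟩, ⟨(n-9*m)%3, by omega⟩, ?_, by simp; omega⟩
        have := get_conn m a t ⟨(n-9*m)/3, by omega⟩ ⟨(n-9*m)%3, by omega⟩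
        have h2 : 9*m + 3 * ((n-9*m)/3) + (n-9*m)%3 = n := by omega
        simp only [h2] at this
        rw [this] at hs
        rw [← Option.some.inj hs]
      · left
        unfold SfullG at hs
        rw [List.getElem?_append_right (by simp only [List.length_append]; omega)] at hs
        have := List.mem_of_getElem? hs
        simp only [SfinalG, List.mem_flatMap] at this
        obtain ⟨_, _, h⟩ := this
        simp at h
        simp [h]

theorem adj_x (m : ℕ) (u : Fin m × GadgetV) (j : Fin m)
    (h : (disjointGadgets m).Adj (j, .x) u) : u = (j, .s) ∨ ∃ i, u = (j, .la i) := by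
  obtain ⟨j', g⟩ := u
  simp [disjointGadgets, gadgetRel] at h
  aesop

theorem adj_s (m : ℕ) (u : Fin m × GadgetV) (j : Fin m)
    (h : (disjointGadgets m).Adj (j, .s) u) : u = (j, .x) := by
  obtain ⟨j', g⟩ := u
  simp [disjointGadgets, gadgetRel] at h
  aesop

theorem adj_lb (m : ℕ) (u : Fin m × GadgetV) (j : Fin m) (i)
    (h : (disjointGadgets m).Adj (j, .lb i) u) : u = (j, .la i) := by
  obtain ⟨j', g⟩ := u
  simp [disjointGadgets, gadgetRel] at h
  aesop

theorem adj_la (m : ℕ) (u : Fin m × GadgetV) (j : Fin m) (i)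
    (h : (disjointGadgets m).Adj (j, .la i) u) : u = (j, .x) ∨ u = (j, .lb i) := by
  obtain ⟨j', g⟩ := u
  simp [disjointGadgets, gadgetRel] at h
  aesop

theorem comb (m : ℕ) (u v w : Fin m × Fin 3 → Fin m × GadgetV) (T : Fin m × Fin 3 → ℕ)
    (O : Fin m × Fin 3 → Fin m × GadgetV → Prop)
    (hO : ∀ k y, O k y ↔ y = u k ∨ y = v k)
    (hne : ∀ k, u k ≠ v k)
    (hu : ∀ k, (disjointGadgets m).Adj (w k) (u k))
    (hv : ∀ k, (disjointGadgets m).Adj (w k) (v k))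
    (hdis : ∀ k k' y, O k y → O k' y → k = k')
    (hord : ∀ k k', O k' (w k) → T k' < T k) (j : Fin m) :
    ∃ i k0, O k0 (j, .x) ∧ O k0 (j, .lb i) ∧ (∃ k, O k (j, .s)) ∧
      (∀ l, l ≠ i → ∃ k, O k (j, .la l)) ∧ (∀ k, ¬ O k (j, .la i)) ∧
      (∀ k l, l ≠ i → ¬ O k (j, .lb l)) ∧
      (Finset.univ.filter (fun k => (w k).1 = j)).card = 3 := by
  have hadj : ∀ k y, O k y → (disjointGadgets m).Adj (w k) y := by
    intro k y h
    rcases (hO k y).1 h with rfl | rfl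
    · exact hu k
    · exact hv k
  have hcls : ∀ k j, (w k).1 = j →
      (w k = (j, .x) ∧ ∀ y, O k y → y = (j, .s) ∨ ∃ i, y = (j, .la i)) ∨
      ∃ i, w k = (j, .la i) ∧ O k (j, .x) ∧ O k (j, .lb i) ∧
        ∀ y, O k y → y = (j, .x) ∨ y = (j, .lb i) := by
    intro k j hj
    have h1 := hu k
    have h2 := hv k
    have h3 := hne k
    have h4 := hadj k
    rcases hw : w k with ⟨j', g⟩
    rw [hw] at h1 h2 h4 hj
    simp only at hj
    subst hj
    rcases g with _ | _ | i | i
    · left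
      exact ⟨rfl, fun y hy => adj_x m y _ (h4 y hy)⟩
    · exact absurd ((adj_s m _ _ h1).trans (adj_s m _ _ h2).symm) h3
    · right
      refine ⟨i, rfl, ?_, ?_, fun y hy => adj_la m y _ _ (h4 y hy)⟩
      · rw [hO]
        rcases adj_la m _ _ _ h1 with e1 | e1
        · exact Or.inl e1.symm
        · rcases adj_la m _ _ _ h2 with e2 | e2
          · exact Or.inr e2.symm
          · exact absurd (e1.trans e2.symm) h3
      · rw [hO]
        rcases adj_la m _ _ _ h1 with e1 | e1
        · rcases adj_la m _ _ _ h2 with e2 | e2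
          · exact absurd (e1.trans e2.symm) h3
          · exact Or.inr e2.symm
        · exact Or.inl e1.symm
    · exact absurd ((adj_lb m _ _ _ h1).trans (adj_lb m _ _ _ h2).symm) h3
  let X : Fin m → Finset (Fin m × Fin 3) := fun j => Finset.univ.filter (fun k => w k = (j, .x))
  let L : Fin m → Finset (Fin m × Fin 3) := fun j =>
    Finset.univ.filter (fun k => (w k).1 = j ∧ w k ≠ (j, .x))
  let F : Fin m → Finset (Fin m × GadgetV) := fun j => (X j).biUnion (fun k => {u k, v k})
  have hFmem : ∀ j y, y ∈ F j ↔ ∃ k, w k = (j, .x) ∧ O k y := by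
    intro j y
    simp [F, X, hO]
  have hFcard : ∀ j, (F j).card = (X j).card * 2 := by
    intro j
    simp only [F]
    rw [Finset.card_biUnion]
    · rw [Finset.sum_const_nat (m := 2)]
      intro k _
      exact Finset.card_pair (hne k)
    · intro k _ k' _ hkk
      rw [Function.onFun, Finset.disjoint_left]
      intro y hy hy'
      simp only [Finset.mem_insert, Finset.mem_singleton] at hy hy'
      exact hkk (hdis k k' y ((hO _ _).2 hy) ((hO _ _).2 hy'))
  have hL : ∀ j, (L j).card ≤ 1 := by
    intro j
    rw [Finset.card_le_one]
    intro k hk k' hk'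
    simp only [L, Finset.mem_filter, Finset.mem_univ, true_and] at hk hk'
    rcases hcls k j hk.1 with h | ⟨i, _, h, _⟩
    · exact absurd h.1 hk.2
    rcases hcls k' j hk'.1 with h' | ⟨i', _, h', _⟩
    · exact absurd h'.1 hk'.2
    exact hdis k k' _ h h'
  have hX : ∀ j, (X j).card ≤ 2 := by
    intro j
    have hsub : F j ⊆ insert (j, .s) (Finset.univ.image (fun i : Fin 4 => (j, GadgetV.la i))) := by
      intro y hy
      obtain ⟨k, hk, hy⟩ := (hFmem j y).1 hy
      rcases hcls k j (by rw [hk]) with ⟨_, h⟩ | ⟨i, h, _⟩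
      · rcases h y hy with h | ⟨i, h⟩ <;> simp [h]
      · rw [hk] at h; simp at h
    have h1 := Finset.card_le_card hsub
    have h2 := Finset.card_insert_le (j, GadgetV.s)
      (Finset.univ.image (fun i : Fin 4 => (j, GadgetV.la i)))
    have h3 := Finset.card_image_le (s := Finset.univ) (f := fun i : Fin 4 => (j, GadgetV.la i))
    simp only [Finset.card_univ, Fintype.card_fin] at h3
    have := hFcard j
    omega
  have hXL : ∀ j, (Finset.univ.filter (fun k => (w k).1 = j)).card = (X j).card + (L j).card := by
    intro j
    rw [← Finset.card_union_of_disjoint]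
    · congr 1
      ext k
      simp only [X, L, Finset.mem_filter, Finset.mem_univ, true_and, Finset.mem_union]
      constructor
      · intro h
        by_cases h' : w k = (j, .x)
        · exact Or.inl h'
        · exact Or.inr ⟨h, h'⟩
      · rintro (h | h)
        · rw [h]
        · exact h.1
    · rw [Finset.disjoint_left]
      intro k hk hk'
      simp only [X, L, Finset.mem_filter, Finset.mem_univ, true_and] at hk hk'
      exact hk'.2 hk
  have hcard : ∀ j, (Finset.univ.filter (fun k => (w k).1 = j)).card = 3 := by
    have hle : ∀ j ∈ (Finset.univ : Finset (Fin m)),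
        (Finset.univ.filter (fun k => (w k).1 = j)).card ≤ 3 := by
      intro j _
      have := hL j; have := hX j; have := hXL j; omega
    have htot := Finset.card_eq_sum_card_fiberwise (f := fun k => (w k).1)
      (s := (Finset.univ : Finset (Fin m × Fin 3))) (t := Finset.univ) (fun _ _ => by simp)
    have heq : ∑ j : Fin m, (Finset.univ.filter (fun k => (w k).1 = j)).card
        = ∑ j : Fin m, 3 := by
      rw [← htot]; simp
    intro j
    exact (Finset.sum_eq_sum_iff_of_le hle).1 heq j (Finset.mem_univ j)
  have hX2 : (X j).card = 2 := by
    have := hL j; have := hX j; have := hXL j; have := hcard j; omega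
  have hL1 : (L j).card = 1 := by
    have := hL j; have := hX j; have := hXL j; have := hcard j; omega
  obtain ⟨k0, hk0⟩ := Finset.card_pos.1 (by omega : 0 < (L j).card)
  simp only [L, Finset.mem_filter, Finset.mem_univ, true_and] at hk0
  rcases hcls k0 j hk0.1 with h | ⟨i, hw0, hx0, hb0, hy0⟩
  · exact absurd h.1 hk0.2
  have hgad : ∀ k g, O k (j, g) → (w k).1 = j := by
    intro k g h
    rcases hcls k _ rfl with ⟨_, h'⟩ | ⟨i, _, _, _, h'⟩
    · rcases h' _ h with h | ⟨_, h⟩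
      · exact (congrArg Prod.fst h).symm
      · exact (congrArg Prod.fst h).symm
    · rcases h' _ h with h | h
      · exact (congrArg Prod.fst h).symm
      · exact (congrArg Prod.fst h).symm
  have hLk : ∀ k, (w k).1 = j → w k = (j, .x) ∨ k = k0 := by
    intro k hk
    rcases hcls k j hk with h | ⟨i, _, h, _⟩
    · exact Or.inl h.1
    · exact Or.inr (hdis _ _ _ h hx0)
  have hla : ∀ k, ¬ O k (j, .la i) := by
    intro k hk
    rcases hLk k (hgad k _ hk) with h | rfl
    · have h1 := hord k0 k (by rw [hw0]; exact hk)
      have h2 := hord k k0 (by rw [h]; exact hx0)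
      omega
    · rcases hy0 _ hk with h | h <;> simp at h
  have hFeq : F j = insert (j, .s)
      ((Finset.univ.erase i).image (fun i : Fin 4 => (j, GadgetV.la i))) := by
    apply Finset.eq_of_subset_of_card_le
    · intro y hy
      obtain ⟨k, hk, hy⟩ := (hFmem j y).1 hy
      rcases hcls k j (by rw [hk]) with ⟨_, h⟩ | ⟨i, h, _⟩
      · rcases h y hy with rfl | ⟨i', rfl⟩
        · simp
        · have : i' ≠ i := by rintro rfl; exact hla k hy
          simp [this]
      · rw [hk] at h; simp at h
    · have h2 := Finset.card_insert_le (j, GadgetV.s)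
        ((Finset.univ.erase i).image (fun i : Fin 4 => (j, GadgetV.la i)))
      have h3 := Finset.card_image_le (s := Finset.univ.erase i)
        (f := fun i : Fin 4 => (j, GadgetV.la i))
      rw [Finset.card_erase_of_mem (Finset.mem_univ i)] at h3
      simp only [Finset.card_univ, Fintype.card_fin] at h3
      have := hFcard j
      omega
  refine ⟨i, k0, hx0, hb0, ?_, ?_, hla, ?_, hcard j⟩
  · obtain ⟨k, _, h⟩ := (hFmem j (j, .s)).1 (by rw [hFeq]; simp)
    exact ⟨k, h⟩
  · intro l hl
    obtain ⟨k, _, h⟩ := (hFmem j (j, .la l)).1 (by rw [hFeq]; simp [hl])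
    exact ⟨k, h⟩
  · intro k l hl h
    rcases hcls k j (hgad k _ h) with ⟨_, h'⟩ | ⟨i', hw', hx', _, h'⟩
    · rcases h' _ h with h | ⟨_, h⟩ <;> simp at h
    · have := hdis _ _ _ hx' hx0
      subst this
      rcases hy0 _ h with h | h <;> simp at h
      exact hl h

/-- in any emptying placement of the 3-Partition-derived instance on `m`
disjoint gadgets, after placing `S_initial` (the first `6m` stacks) every gadget `j` has,
for some arm `i`: `la i` and all `lb k` (`k ≠ i`) empty; `x` and `lb i` holding stacks
of the same color; `s` and the other `la k` occupied; and the six stacks placed on the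
gadget use exactly three colors, each with both of its stacks inside that gadget. -/
theorem statement_6 (m B : ℕ) (hB : 0 < B) (a : Fin (3*m) → ℕ)
    (ha : ∀ i, B < 4 * a i ∧ 2 * a i < B)
    (hsum : ∑ i, a i = m * B)
    (p : List (Fin m × GadgetV))
    (hleg : Legal (disjointGadgets m) (B+4)
      (emptyConfig (Fin m × GadgetV) (GColor m)) (SfullG m a (B+4)) p)
    (hemp : play (disjointGadgets m) (B+4)
      (emptyConfig (Fin m × GadgetV) (GColor m)) (SfullG m a (B+4)) p =
      emptyConfig (Fin m × GadgetV) (GColor m)) :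
    ∀ δ0 : Config (Fin m × GadgetV) (GColor m),
      δ0 = play (disjointGadgets m) (B+4) (emptyConfig (Fin m × GadgetV) (GColor m))
        ((SfullG m a (B+4)).take (6*m)) (p.take (6*m)) →
      ∀ j : Fin m, ∃ i : Fin 4,
        δ0 (j, GadgetV.la i) = none ∧
        (∀ k : Fin 4, k ≠ i → δ0 (j, GadgetV.lb k) = none) ∧
        (∃ (c : GColor m) (h1 h2 : ℕ),
          δ0 (j, GadgetV.x) = some (c, h1) ∧ δ0 (j, GadgetV.lb i) = some (c, h2)) ∧
        δ0 (j, GadgetV.s) ≠ none ∧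
        (∀ k : Fin 4, k ≠ i → δ0 (j, GadgetV.la k) ≠ none) ∧
        (∃ cs : Finset (GColor m), cs.card = 3 ∧
          ∀ (q : ℕ) (sq : GColor m × ℕ) (wq : Fin m × GadgetV), q < 6*m →
            (SfullG m a (B+4))[q]? = some sq → p[q]? = some wq →
            (wq.1 = j ↔ sq.1 ∈ cs)) := by
  intro δ0 hδ0 j
  obtain ⟨hplen, hsteps⟩ := legal_steps _ _ _ _ _ hleg
  have hSlen := len_full m a (B+4)
  let st : ℕ → GColor m × ℕ := fun n => (SfullG m a (B+4))[n]?.getD (none, 0)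
  let w : ℕ → Fin m × GadgetV := fun n => p[n]?.getD (j, .x)
  let conf : ℕ → Config (Fin m × GadgetV) (GColor m) := fun n =>
    play (disjointGadgets m) (B+4) (emptyConfig (Fin m × GadgetV) (GColor m))
        ((SfullG m a (B+4)).take n) (p.take n)
  have hst : ∀ n, n < 16*m → (SfullG m a (B+4))[n]? = some (st n) := by
    intro n hn
    simp only [st]
    rw [List.getElem?_eq_getElem (by omega)]
    rfl
  have hw : ∀ n, n < 16*m → p[n]? = some (w n) := by
    intro n hn
    simp only [w]
    rw [List.getElem?_eq_getElem (by omega)]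
    rfl
  have hstep : ∀ n < 16*m, conf n (w n) = none ∧
      conf (n+1) = place (disjointGadgets m) (B+4) (conf n) (st n) (w n) :=
    fun n hn => hsteps n (st n) (w n) (hst n hn) (hw n hn)
  have hc0 : conf 0 = emptyConfig _ _ := by simp [conf, play]
  have hcN : conf (16*m) = emptyConfig _ _ := by
    simp only [conf]
    rw [List.take_of_length_le (by omega), List.take_of_length_le (by omega)]
    exact hemp
  have hsi : ∀ (k : Fin m × Fin 3) (e : Fin 2),
      st (6*k.1.1+2*k.2.1+e.1) = (some k, B+3) := by
    intro k e
    simp only [st, get_init m a (B+4) k.1 k.2 e]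
    rfl
  have hsc : ∀ (k : Fin m × Fin 3), st (9*m+3*k.1.1+k.2.1) = (some k, B+3) := by
    intro k
    simp only [st, get_conn m a (B+4) k.1 k.2]
    rfl
  have hcore : ∀ k : Fin m × Fin 3, _ := fun k =>
    core (disjointGadgets m) (B+4) (16*m) conf st w hc0 hcN hstep (some k) (B+3)
      (6*k.1.1+2*k.2.1) (6*k.1.1+2*k.2.1+1) (9*m+3*k.1.1+k.2.1)
      (by omega) (by omega) (by omega) (by omega) (by omega)
      (by simpa using hsi k 0) (by simpa using hsi k 1) (hsc k) (by
        intro n hn e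
        rcases color_cases m a (B+4) n (st n) (hst n hn) with
          ⟨_, j', d, e', h1, h2⟩ | ⟨_, h1 | ⟨j', d, h1, h2⟩⟩
        · rw [e] at h1
          obtain rfl := Option.some.inj h1
          simp only
          omega
        · rw [e] at h1; simp at h1
        · rw [e] at h1
          obtain rfl := Option.some.inj h1
          simp only
          omega)
  have hδc : δ0 = conf (6*m) := hδ0
  let O : Fin m × Fin 3 → Fin m × GadgetV → Prop := fun k y =>
    y = w (6*k.1.1+2*k.2.1) ∨ y = w (6*k.1.1+2*k.2.1+1)
  have hat : ∀ k n, 6*m ≤ n → n ≤ 9*m+3*k.1.1+k.2.1 → ∀ v h,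
      conf n v = some (some k, h) ↔ O k v ∧ h = B+3 := fun k n h1 h2 =>
    (hcore k).2.2.2 n (by omega) h2
  have hat0 : ∀ k v h, δ0 v = some (some k, h) ↔ O k v ∧ h = B+3 := by
    intro k; rw [hδc]; exact hat k (6*m) le_rfl (by omega)
  have hnone : ∀ v, (∀ k, ¬ O k v) → δ0 v = none := by
    intro v hv
    rcases hd : δ0 v with _ | ⟨_ | k, h⟩
    · rfl
    · exfalso
      rw [hδc, frame (disjointGadgets m) (B+4) (16*m) conf st w hstep none 0 (6*m)
        (by omega) (by omega) ?_, hc0] at hd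
      · simp [emptyConfig] at hd
      · intro n _ hn
        rcases color_cases m a (B+4) n (st n) (hst n (by omega)) with
          ⟨_, j', d, e', h1, h2⟩ | ⟨h, _⟩
        · rw [h1]; simp
        · omega
    · exact absurd ((hat0 k v h).1 hd).1 (hv k)
  have hsome : ∀ v k, O k v → δ0 v = some (some k, B+3) := fun v k h =>
    (hat0 k v _).2 ⟨h, rfl⟩
  obtain ⟨i, k0, hx, hb, ⟨ks, hs⟩, hl, hla, hlb, hcard⟩ := comb m
    (fun k => w (6*k.1.1+2*k.2.1)) (fun k => w (6*k.1.1+2*k.2.1+1))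
    (fun k => w (9*m+3*k.1.1+k.2.1)) (fun k => 9*m+3*k.1.1+k.2.1) O
    (fun k y => Iff.rfl) (fun k => (hcore k).1) (fun k => (hcore k).2.1)
    (fun k => (hcore k).2.2.1)
    (by
      intro k k' y h h'
      have h1 := hsome y k h
      have h2 := hsome y k' h'
      rw [h1] at h2
      simpa using h2)
    (by
      intro k k' h
      by_contra hlt
      have h1 := (hat k' (9*m+3*k.1.1+k.2.1) (by omega) (by omega) _ _).2 ⟨h, rfl⟩
      rw [(hstep _ (by omega)).1] at h1
      simp at h1) j
  refine ⟨i, hnone _ hla, fun k hk => hnone _ (fun k' => hlb k' k hk),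
    ⟨some k0, B+3, B+3, hsome _ _ hx, hsome _ _ hb⟩, ?_, ?_, ?_⟩
  · rw [hsome _ _ hs]; simp
  · intro l hli
    obtain ⟨k, hk⟩ := hl l hli
    rw [hsome _ _ hk]; simp
  · refine ⟨(Finset.univ.filter (fun k : Fin m × Fin 3 =>
      (w (9*m+3*k.1.1+k.2.1)).1 = j)).map Function.Embedding.some, ?_, ?_⟩
    · rw [Finset.card_map]; exact hcard
    · intro q sq wq hq hsq hwq
      have hwq' : wq = w q := Option.some.inj (hwq.symm.trans (hw q (by omega)))
      rcases color_cases m a (B+4) q sq hsq with ⟨_, j', d, e, h1, h2⟩ | ⟨h, _⟩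
      · have hg : (w (9*m+3*j'.1+d.1)).1 = (w q).1 := by
          have hadj : (disjointGadgets m).Adj (w (9*m+3*j'.1+d.1)) (w q) := by
            have hc := hcore (j', d)
            have he : e.1 = 0 ∨ e.1 = 1 := by omega
            rcases he with he | he
            · rw [h2, he]; exact hc.2.1
            · rw [h2, he]; exact hc.2.2.1
          simp only [disjointGadgets, SimpleGraph.fromRel_adj] at hadj
          rcases hadj.2 with h | h
          · exact h.1
          · exact h.1.symm
        rw [h1, hwq', ← hg]
        simp
      · omega


end Hexasort
end
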